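/- arXiv:2406.06272 — 4 statements merged into one kernel-verified Lean document; each statement's English description precedes it below -/
import Mathlib

section
/- Discrete Sobolev embedding uniform in the mesh size: for every L > 0 there exists a constant C₂ > 0 depending only on L such that for every integer N ≥ 1 (with h = L/N) and every periodic grid function f, one has ‖f‖_∞ ≤ C₂ ( |f̄| + ‖Δ_h f‖₂ ). -/
/-- Discrete Laplacian `(Δ_h f)(v) = ∑ᵢ (f(v+eᵢ) − 2f(v) + f(v−eᵢ))/h²`. -/
noncomputable def gridLap (N : ℕ) (h : ℝ) (f : (Fin 3 → ZMod N) → ℝ)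
    (v : Fin 3 → ZMod N) : ℝ :=
  ∑ i : Fin 3, (f (v + Pi.single i 1) - 2 * f v + f (v - Pi.single i 1)) / h ^ 2

/-- Discrete `ℓ²` norm `‖f‖₂ = (h³ ∑_v f(v)²)^{1/2}`. -/
noncomputable def gridL2 (N : ℕ) [NeZero N] (h : ℝ) (f : (Fin 3 → ZMod N) → ℝ) : ℝ :=
  Real.sqrt (h ^ 3 * ∑ v : Fin 3 → ZMod N, f v ^ 2)

/-- Discrete maximum norm `‖f‖_∞ = max_v |f(v)|`. -/
noncomputable def gridMax (N : ℕ) [NeZero N] (f : (Fin 3 → ZMod N) → ℝ) : ℝ :=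
  Finset.univ.sup' Finset.univ_nonempty fun v => |f v|

/-- Mean `f̄ = N^{−3} ∑_v f(v)`. -/
noncomputable def gridMean (N : ℕ) [NeZero N] (f : (Fin 3 → ZMod N) → ℝ) : ℝ :=
  (∑ v : Fin 3 → ZMod N, f v) / (N : ℝ) ^ 3

open Finset

/-- The additive character `v ↦ exp (2πi (k ⬝ v) / N)` of the periodic grid. -/
noncomputable def gridChar (N : ℕ) [NeZero N] (k v : Fin 3 → ZMod N) : ℂ :=
  ZMod.stdAddChar (k ⬝ᵥ v)

/-- The discrete Fourier transform of a periodic grid function. -/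
noncomputable def gridFourier (N : ℕ) [NeZero N] (f : (Fin 3 → ZMod N) → ℝ)
    (k : Fin 3 → ZMod N) : ℂ :=
  ∑ v, gridChar N k v * f v

/-- The weight `(1 + n²)^(-2/3)`, summable over the integers. -/
noncomputable def latticeWeight (n : ℤ) : ℝ := (1 + (n : ℝ) ^ 2) ^ (-(2 / 3) : ℝ)

section Characters

variable {N : ℕ} [NeZero N]

theorem gridChar_add (k v w : Fin 3 → ZMod N) :
    gridChar N k (v + w) = gridChar N k v * gridChar N k w := by
  simp [gridChar, dotProduct_add, AddChar.map_add_eq_mul]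

theorem norm_gridChar (k v : Fin 3 → ZMod N) : ‖gridChar N k v‖ = 1 :=
  AddChar.norm_apply _ _

theorem conj_gridChar (k v : Fin 3 → ZMod N) :
    (starRingEnd ℂ) (gridChar N k v) = gridChar N k (-v) := by
  rw [gridChar, gridChar, dotProduct_neg, AddChar.map_neg_eq_conj]

theorem sum_gridChar (v : Fin 3 → ZMod N) :
    ∑ k, gridChar N k v = if v = 0 then (N : ℂ) ^ 3 else 0 := by
  have hprod : ∀ k, gridChar N k v = ∏ i, ZMod.stdAddChar (k i * v i) := fun k => by
    simp [gridChar, dotProduct, Fin.sum_univ_three, Fin.prod_univ_three, AddChar.map_add_eq_mul]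
  simp_rw [hprod]
  rw [← Fintype.piFinset_univ,
    ← prod_univ_sum (fun _ => univ) (fun i (j : ZMod N) => (ZMod.stdAddChar (j * v i) : ℂ))]
  simp_rw [AddChar.sum_mulShift _ (ZMod.isPrimitive_stdAddChar N)]
  split_ifs with hv
  · simp [hv, ZMod.card]
  · obtain ⟨i, hi⟩ := Function.ne_iff.1 hv
    exact prod_eq_zero (mem_univ i) (by rw [if_neg (show ¬v i = 0 from hi), Nat.cast_zero])

theorem gridFourier_inversion (f : (Fin 3 → ZMod N) → ℝ) (v : Fin 3 → ZMod N) :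
    ∑ k, gridFourier N f k * gridChar N k (-v) = (N : ℂ) ^ 3 * f v := by
  simp_rw [gridFourier, sum_mul]
  rw [sum_comm]
  have h : ∀ w k : Fin 3 → ZMod N,
      gridChar N k w * f w * gridChar N k (-v) = f w * gridChar N k (w - v) := fun w k => by
    rw [sub_eq_add_neg, gridChar_add]; ring
  simp_rw [h, ← mul_sum, sum_gridChar, sub_eq_zero]
  simp [mul_comm]

theorem sum_norm_gridFourier_sq (f : (Fin 3 → ZMod N) → ℝ) :
    ∑ k, ‖gridFourier N f k‖ ^ 2 = (N : ℝ) ^ 3 * ∑ v, f v ^ 2 := by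
  have hconj : ∀ k, (starRingEnd ℂ) (gridFourier N f k) = ∑ v, gridChar N k (-v) * f v :=
    fun k => by simp [gridFourier, conj_gridChar]
  have h : ((∑ k, ‖gridFourier N f k‖ ^ 2 : ℝ) : ℂ) = ((N : ℝ) ^ 3 * ∑ v, f v ^ 2 : ℝ) := by
    push_cast
    simp_rw [← Complex.mul_conj', hconj, mul_sum]
    rw [sum_comm]
    refine sum_congr rfl fun v _ => ?_
    simp_rw [← mul_assoc]
    rw [← sum_mul, gridFourier_inversion]
    ring
  exact_mod_cast h

theorem gridFourier_zero (f : (Fin 3 → ZMod N) → ℝ) :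
    gridFourier N f 0 = (N : ℂ) ^ 3 * gridMean N f := by
  have hN : (N : ℂ) ≠ 0 := Nat.cast_ne_zero.2 (NeZero.ne N)
  simp only [gridFourier, gridChar, zero_dotProduct, AddChar.map_zero_eq_one, one_mul, gridMean]
  push_cast
  field_simp

theorem gridFourier_shift (f : (Fin 3 → ZMod N) → ℝ) (k w : Fin 3 → ZMod N) :
    ∑ v, gridChar N k v * f (v + w) = gridChar N k (-w) * gridFourier N f k := by
  rw [gridFourier, mul_sum, ← Equiv.sum_comp (Equiv.addRight w)
    (fun v => gridChar N k (-w) * (gridChar N k v * f v))]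
  refine sum_congr rfl fun v _ => ?_
  rw [Equiv.coe_addRight, ← mul_assoc, ← gridChar_add, neg_add_cancel_comm_assoc]

theorem stdAddChar_add_neg (j : ZMod N) :
    (ZMod.stdAddChar j + ZMod.stdAddChar (-j) : ℂ) =
      (2 * Real.cos (2 * Real.pi * j.valMinAbs / N) : ℝ) := by
  have h : (ZMod.stdAddChar j : ℂ) =
      Complex.exp ((2 * Real.pi * j.valMinAbs / N : ℝ) * Complex.I) := by
    conv_lhs => rw [← ZMod.coe_valMinAbs j, ZMod.stdAddChar_coe]
    congr 1
    push_cast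
    ring
  rw [AddChar.map_neg_eq_conj, Complex.add_conj, h, Complex.exp_ofReal_mul_I_re]

theorem gridFourier_gridLap (h : ℝ) (f : (Fin 3 → ZMod N) → ℝ) (k : Fin 3 → ZMod N) :
    gridFourier N (gridLap N h f) k =
      -((∑ i, (2 - 2 * Real.cos (2 * Real.pi * (k i).valMinAbs / N)) / h ^ 2 : ℝ) : ℂ) *
        gridFourier N f k := by
  have hterm : ∀ i : Fin 3, ∑ v, gridChar N k v *
      (((f (v + Pi.single i 1) - 2 * f v + f (v - Pi.single i 1)) / h ^ 2 : ℝ) : ℂ) =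
      -(((2 - 2 * Real.cos (2 * Real.pi * (k i).valMinAbs / N)) / h ^ 2 : ℝ) : ℂ) *
        gridFourier N f k := fun i => by
    have hsplit : ∀ v, gridChar N k v *
        (((f (v + Pi.single i 1) - 2 * f v + f (v - Pi.single i 1)) / h ^ 2 : ℝ) : ℂ) =
        (gridChar N k v * f (v + Pi.single i 1) - 2 * (gridChar N k v * f v) +
          gridChar N k v * f (v + -Pi.single i 1)) / (h : ℂ) ^ 2 := fun v => by
      rw [← sub_eq_add_neg v]; push_cast; ring
    simp_rw [hsplit]
    rw [← sum_div, sum_add_distrib, sum_sub_distrib, ← mul_sum, gridFourier_shift,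
      gridFourier_shift, ← gridFourier]
    have hc := stdAddChar_add_neg (k i)
    have h₁ : gridChar N k (Pi.single i 1) = ZMod.stdAddChar (k i) := by simp [gridChar]
    have h₂ : gridChar N k (-Pi.single i 1) = ZMod.stdAddChar (-k i) := by simp [gridChar]
    rw [neg_neg, h₁, h₂]
    push_cast at hc ⊢
    linear_combination gridFourier N f k / (h : ℂ) ^ 2 * hc
  simp only [gridFourier, gridLap] at hterm ⊢
  simp_rw [Complex.ofReal_sum, mul_sum]
  rw [sum_comm]
  simp_rw [← mul_sum, hterm, ← sum_neg_distrib, sum_mul]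

theorem two_sub_two_mul_cos_ge (j : ZMod N) :
    16 * (j.valMinAbs : ℝ) ^ 2 / N ^ 2 ≤
      2 - 2 * Real.cos (2 * Real.pi * j.valMinAbs / N) := by
  have hN : (0 : ℝ) < N := Nat.cast_pos.2 (NeZero.pos N)
  have hmem := j.valMinAbs_mem_Ioc
  have h₁ : -(N : ℝ) < j.valMinAbs * 2 := by exact_mod_cast hmem.1
  have h₂ : (j.valMinAbs : ℝ) * 2 ≤ N := by exact_mod_cast hmem.2
  have habs : |2 * Real.pi * j.valMinAbs / N| ≤ Real.pi := by
    rw [abs_le, le_div_iff₀ hN, div_le_iff₀ hN]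
    constructor <;> nlinarith [Real.pi_pos]
  have hcos := Real.cos_le_one_sub_mul_cos_sq habs
  have heq : 2 / Real.pi ^ 2 * (2 * Real.pi * (j.valMinAbs : ℝ) / N) ^ 2 =
      8 * (j.valMinAbs : ℝ) ^ 2 / N ^ 2 := by
    field_simp
    ring
  rw [heq] at hcos
  linarith [show 16 * (j.valMinAbs : ℝ) ^ 2 / N ^ 2 = 2 * (8 * (j.valMinAbs : ℝ) ^ 2 / N ^ 2) by
    ring]

end Characters

theorem latticeWeight_nonneg (n : ℤ) : 0 ≤ latticeWeight n := by
  unfold latticeWeight; positivity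

theorem summable_latticeWeight : Summable latticeWeight := by
  have hs : Summable fun n : ℤ => |(n : ℝ)| ^ (-(4 / 3) : ℝ) + if n = 0 then 1 else 0 :=
    (Real.summable_abs_int_rpow (by norm_num)).add
      (summable_of_ne_finset_zero (s := {0}) fun n hn => by simpa using hn)
  refine hs.of_nonneg_of_le latticeWeight_nonneg fun n => ?_
  by_cases hn : n = 0
  · simp [hn, latticeWeight]
  · have hpos : 0 < |(n : ℝ)| := abs_pos.2 (Int.cast_ne_zero.2 hn)
    have heq : |(n : ℝ)| ^ (-(4 / 3) : ℝ) = ((n : ℝ) ^ 2) ^ (-(2 / 3) : ℝ) := by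
      rw [← sq_abs, ← Real.rpow_natCast, ← Real.rpow_mul hpos.le]
      norm_num
    rw [if_neg hn, add_zero, heq, latticeWeight]
    exact Real.rpow_le_rpow_of_nonpos (by positivity) (by linarith) (by norm_num)

theorem sum_prod_latticeWeight_le (N : ℕ) [NeZero N] :
    ∑ k : Fin 3 → ZMod N, ∏ i, latticeWeight (k i).valMinAbs ≤ (∑' n, latticeWeight n) ^ 3 := by
  rw [← Fintype.piFinset_univ,
    ← prod_univ_sum (fun _ => univ) (fun _ (j : ZMod N) => latticeWeight j.valMinAbs),
    prod_const, card_univ, Fintype.card_fin]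
  have hinj : Function.Injective (ZMod.valMinAbs : ZMod N → ℤ) := ZMod.injective_valMinAbs
  gcongr
  · exact sum_nonneg fun j _ => latticeWeight_nonneg _
  · calc ∑ j : ZMod N, latticeWeight j.valMinAbs
        = ∑ n ∈ univ.map ⟨_, hinj⟩, latticeWeight n := by simp
      _ ≤ ∑' n, latticeWeight n :=
        summable_latticeWeight.sum_le_tsum _ fun n _ => latticeWeight_nonneg n

theorem inv_sq_le_prod_latticeWeight (m : Fin 3 → ℤ) :
    ((1 + ∑ i, (m i : ℝ) ^ 2)⁻¹) ^ 2 ≤ ∏ i, latticeWeight (m i) := by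
  set s : ℝ := 1 + ∑ i, (m i : ℝ) ^ 2 with hs
  have hspos : 0 < s := by positivity
  have hle : ∏ i, (1 + (m i : ℝ) ^ 2) ≤ s ^ (3 : ℕ) := by
    calc ∏ i, (1 + (m i : ℝ) ^ 2) ≤ ∏ _i : Fin 3, s := by
          refine prod_le_prod (fun i _ => by positivity) fun i _ => ?_
          rw [hs]
          gcongr
          exact single_le_sum (f := fun i => (m i : ℝ) ^ 2) (fun i _ => sq_nonneg _) (mem_univ i)
      _ = s ^ 3 := by simp
  have heq : (s⁻¹) ^ 2 = (s ^ (3 : ℕ)) ^ (-(2 / 3) : ℝ) := by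
    rw [← Real.rpow_natCast s 3, ← Real.rpow_mul hspos.le, inv_pow, ← Real.rpow_natCast s 2,
      ← Real.rpow_neg hspos.le]
    norm_num
  simp only [latticeWeight]
  rw [heq, Real.finsetProd_rpow _ _ fun i _ => by positivity]
  exact Real.rpow_le_rpow_of_nonpos (prod_pos fun i _ => by positivity) hle (by norm_num)

theorem norm_gridFourier_le {N : ℕ} [NeZero N] {L : ℝ} (hL : 0 < L)
    (f : (Fin 3 → ZMod N) → ℝ) {k : Fin 3 → ZMod N} (hk : k ≠ 0) :
    ‖gridFourier N f k‖ ≤ L ^ 2 / 8 *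
      ((1 + ∑ i, ((k i).valMinAbs : ℝ) ^ 2)⁻¹ * ‖gridFourier N (gridLap N (L / N) f) k‖) := by
  have hN : (0 : ℝ) < N := Nat.cast_pos.2 (NeZero.pos N)
  set m : ℝ := ∑ i, ((k i).valMinAbs : ℝ) ^ 2 with hm
  have hm_one : 1 ≤ m := by
    obtain ⟨i, hi⟩ := Function.ne_iff.1 hk
    have h₀ : (k i).valMinAbs ≠ 0 := by simpa using hi
    have h₁ : (1 : ℝ) ≤ ((k i).valMinAbs : ℝ) ^ 2 := by
      exact_mod_cast Int.one_le_abs (pow_ne_zero 2 h₀) |>.trans_eq (abs_of_nonneg (sq_nonneg _))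
    exact h₁.trans (single_le_sum (f := fun i => ((k i).valMinAbs : ℝ) ^ 2)
      (fun i _ => sq_nonneg _) (mem_univ i))
  rw [gridFourier_gridLap, norm_mul, norm_neg, Complex.norm_real]
  set c : ℝ := ∑ i, (2 - 2 * Real.cos (2 * Real.pi * (k i).valMinAbs / N)) / (L / N) ^ 2 with hc
  have hmc : 16 / L ^ 2 * m ≤ c := by
    rw [hm, hc, mul_sum]
    refine sum_le_sum fun i _ => ?_
    rw [le_div_iff₀ (by positivity)]
    refine le_trans (le_of_eq ?_) (two_sub_two_mul_cos_ge (k i))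
    field_simp
  have hc' : 8 / L ^ 2 * (1 + m) ≤ ‖c‖ := by
    refine le_trans (le_trans ?_ hmc) (le_abs_self c)
    rw [div_mul_eq_mul_div, div_mul_eq_mul_div]
    exact div_le_div_of_nonneg_right (by linarith) (by positivity)
  calc ‖gridFourier N f k‖
      = L ^ 2 / 8 * ((1 + m)⁻¹ * (8 / L ^ 2 * (1 + m) * ‖gridFourier N f k‖)) := by
        field_simp
    _ ≤ _ := by gcongr

theorem sum_norm_gridFourier_le {N : ℕ} [NeZero N] {L : ℝ} (hL : 0 < L)
    (f : (Fin 3 → ZMod N) → ℝ) :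
    ∑ k ∈ univ.erase 0, ‖gridFourier N f k‖ ≤ (N : ℝ) ^ 3 *
      (√(L * (∑' n, latticeWeight n) ^ 3) / 8 * gridL2 N (L / N) (gridLap N (L / N) f)) := by
  have hN : (0 : ℝ) < N := Nat.cast_pos.2 (NeZero.pos N)
  have hS : 0 ≤ ∑' n, latticeWeight n := tsum_nonneg latticeWeight_nonneg
  set g := gridLap N (L / N) f
  set a : (Fin 3 → ZMod N) → ℝ := fun k => (1 + ∑ i, ((k i).valMinAbs : ℝ) ^ 2)⁻¹
  have hsum : ∑ k ∈ univ.erase 0, ‖gridFourier N f k‖ ≤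
      L ^ 2 / 8 * ∑ k, a k * ‖gridFourier N g k‖ := by
    rw [mul_sum]
    calc _ ≤ ∑ k ∈ univ.erase 0, L ^ 2 / 8 * (a k * ‖gridFourier N g k‖) :=
          sum_le_sum fun k hk => norm_gridFourier_le hL f (ne_of_mem_erase hk)
      _ ≤ _ := sum_le_sum_of_subset_of_nonneg (erase_subset _ _) fun k _ _ => by positivity
  have hasq : ∑ k, a k ^ 2 ≤ (∑' n, latticeWeight n) ^ 3 :=
    (sum_le_sum fun k _ => inv_sq_le_prod_latticeWeight fun i => (k i).valMinAbs).trans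
      (sum_prod_latticeWeight_le N)
  have hCS := sum_mul_sq_le_sq_mul_sq univ a fun k => ‖gridFourier N g k‖
  rw [sum_norm_gridFourier_sq] at hCS
  have hg0 : 0 ≤ ∑ v, g v ^ 2 := sum_nonneg fun v _ => sq_nonneg _
  refine hsum.trans (abs_le_of_sq_le_sq' ?_ (by rw [gridL2]; positivity)).2
  rw [gridL2, mul_pow, mul_pow, mul_pow, div_pow √_, Real.sq_sqrt (by positivity),
    Real.sq_sqrt (by positivity)]
  calc (L ^ 2 / 8) ^ 2 * (∑ k, a k * ‖gridFourier N g k‖) ^ 2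
      ≤ (L ^ 2 / 8) ^ 2 * ((∑' n, latticeWeight n) ^ 3 * ((N : ℝ) ^ 3 * ∑ v, g v ^ 2)) := by
        gcongr
        exact hCS.trans (by gcongr)
    _ = _ := by
        field_simp

theorem abs_le_gridMean_add_sum_norm_gridFourier {N : ℕ} [NeZero N]
    (f : (Fin 3 → ZMod N) → ℝ) (v : Fin 3 → ZMod N) :
    (N : ℝ) ^ 3 * |f v| ≤ (N : ℝ) ^ 3 * |gridMean N f| +
      ∑ k ∈ univ.erase 0, ‖gridFourier N f k‖ := by
  have hnorm : (N : ℝ) ^ 3 * |f v| = ‖∑ k, gridFourier N f k * gridChar N k (-v)‖ := by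
    rw [gridFourier_inversion]; simp
  have hzero : (N : ℝ) ^ 3 * |gridMean N f| = ‖gridFourier N f 0‖ := by
    rw [gridFourier_zero]; simp
  rw [hnorm, hzero, add_sum_erase univ (fun k => ‖gridFourier N f k‖) (mem_univ 0)]
  exact (norm_sum_le _ _).trans_eq (by simp [norm_gridChar])

/-- Discrete Sobolev embedding, uniform in the mesh size:
`‖f‖_∞ ≤ C₂ (|f̄| + ‖Δ_h f‖₂)` with `C₂` depending only on `L`. -/
theorem discrete_sobolev_embedding (L : ℝ) (hL : 0 < L) :
    ∃ C₂ : ℝ, 0 < C₂ ∧ ∀ (N : ℕ) [NeZero N] (f : (Fin 3 → ZMod N) → ℝ),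
      gridMax N f ≤ C₂ * (|gridMean N f| + gridL2 N (L / N) (gridLap N (L / N) f)) := by
  refine ⟨1 + √(L * (∑' n, latticeWeight n) ^ 3) / 8, by positivity, fun N _ f => ?_⟩
  have hN : (0 : ℝ) < (N : ℝ) ^ 3 := pow_pos (Nat.cast_pos.2 (NeZero.pos N)) 3
  refine sup'_le _ _ fun v _ => ?_
  have hle := (abs_le_gridMean_add_sum_norm_gridFourier f v).trans
    (add_le_add_right (sum_norm_gridFourier_le hL f) _)
  rw [← mul_add, mul_le_mul_iff_right₀ hN] at hle
  set c := √(L * (∑' n, latticeWeight n) ^ 3) / 8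
  have hc0 : 0 ≤ c := by positivity
  have hL2 : 0 ≤ gridL2 N (L / N) (gridLap N (L / N) f) := Real.sqrt_nonneg _
  nlinarith [mul_nonneg hc0 (abs_nonneg (gridMean N f))]
end

section
/- Uniform discrete elliptic estimate: for every L > 0 there exists a constant C₃ > 0 depending only on L such that for every integer N ≥ 1 (with h = L/N) and every periodic grid function f, one has ‖∇_h f‖₂ ≤ C₃ ‖Δ_h f‖₂. -/
/-- Forward difference `(D_i f)(v) = (f(v+eᵢ) − f(v))/h` on the periodic grid `(ZMod N)³`. -/
noncomputable def gridD (N : ℕ) (h : ℝ) (i : Fin 3) (f : (Fin 3 → ZMod N) → ℝ)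
    (v : Fin 3 → ZMod N) : ℝ :=
  (f (v + Pi.single i 1) - f v) / h

/-- Discrete gradient norm `‖∇_h f‖₂ = (h³ ∑_v ∑ᵢ (D_i f)(v)²)^{1/2}`. -/
noncomputable def gridGradNorm (N : ℕ) [NeZero N] (h : ℝ) (f : (Fin 3 → ZMod N) → ℝ) : ℝ :=
  Real.sqrt (h ^ 3 * ∑ v : Fin 3 → ZMod N, ∑ i : Fin 3, gridD N h i f v ^ 2)

/-- The difference `f(v + a) − f(v)` on an additive group. -/
def groupDiff {G : Type*} [AddCommGroup G] (a : G) (f : G → ℝ) (v : G) : ℝ :=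
  f (v + a) - f v

/-- The second difference `f(v + a) − 2f(v) + f(v − a)` on an additive group. -/
def groupDiff₂ {G : Type*} [AddCommGroup G] (a : G) (f : G → ℝ) (v : G) : ℝ :=
  f (v + a) - 2 * f v + f (v - a)

section GroupDiff

variable {G : Type*} [AddCommGroup G]

theorem groupDiff_groupDiff₂ (a b : G) (f : G → ℝ) (v : G) :
    groupDiff b (groupDiff₂ a f) v = groupDiff₂ a (groupDiff b f) v := by
  simp only [groupDiff, groupDiff₂, add_right_comm v b a, sub_add_eq_add_sub]
  ring

variable [Fintype G]

theorem sum_comp_add_right (a : G) (f : G → ℝ) : ∑ v, f (v + a) = ∑ v, f v :=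
  Equiv.sum_comp (Equiv.addRight a) f

/-- Summation by parts. -/
theorem sum_mul_groupDiff₂ (b : G) (u w : G → ℝ) :
    ∑ v, u v * groupDiff₂ b w v = -∑ v, groupDiff b u v * groupDiff b w v := by
  have h := sum_comp_add_right b fun v => u v * (w v - w (v - b))
  simp only [add_sub_cancel_right] at h
  have h' : ∑ v, u v * groupDiff₂ b w v
      = ∑ v, u v * (w (v + b) - w v) - ∑ v, u v * (w v - w (v - b)) := by
    rw [← Finset.sum_sub_distrib]
    refine Finset.sum_congr rfl fun v _ => ?_
    simp only [groupDiff₂]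
    ring
  rw [h', ← h, ← Finset.sum_sub_distrib, ← Finset.sum_neg_distrib]
  refine Finset.sum_congr rfl fun v _ => ?_
  simp only [groupDiff]
  ring

theorem sum_groupDiff₂_mul_groupDiff₂ (a b : G) (f : G → ℝ) :
    ∑ v, groupDiff₂ a f v * groupDiff₂ b f v = ∑ v, groupDiff a (groupDiff b f) v ^ 2 := by
  rw [sum_mul_groupDiff₂]
  simp only [groupDiff_groupDiff₂, mul_comm (groupDiff₂ a _ _)]
  rw [sum_mul_groupDiff₂, neg_neg]
  simp only [sq]

theorem sum_sq_groupDiff_nsmul_le (e : G) (g : G → ℝ) (k : ℕ) :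
    ∑ v, groupDiff (k • e) g v ^ 2 ≤ (k : ℝ) ^ 2 * ∑ v, groupDiff e g v ^ 2 := by
  have htel (v : G) : groupDiff (k • e) g v
      = ∑ j ∈ Finset.range k, groupDiff e g (v + j • e) := by
    have h := Finset.sum_range_sub (fun j : ℕ => g (v + j • e)) k
    simp only [zero_smul, add_zero, succ_nsmul, ← add_assoc] at h
    exact h.symm
  calc ∑ v, groupDiff (k • e) g v ^ 2
      ≤ ∑ v, (k : ℝ) * ∑ j ∈ Finset.range k, groupDiff e g (v + j • e) ^ 2 := by
        refine Finset.sum_le_sum fun v _ => ?_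
        rw [htel]
        simpa using sq_sum_le_card_mul_sum_sq (s := Finset.range k)
          (f := fun j => groupDiff e g (v + j • e))
    _ = (k : ℝ) * ∑ j ∈ Finset.range k, ∑ v, groupDiff e g (v + j • e) ^ 2 := by
        rw [← Finset.mul_sum, Finset.sum_comm]
    _ = (k : ℝ) ^ 2 * ∑ v, groupDiff e g v ^ 2 := by
        simp only [sum_comp_add_right _ fun v => groupDiff e g v ^ 2, Finset.sum_const,
          Finset.card_range, nsmul_eq_mul]
        ring

/-- Poincaré inequality for functions with zero sum along the orbits of `e`. -/
theorem two_mul_sum_sq_le_of_orbit_sum_eq_zero {N : ℕ} (hN : 0 < N) (e : G) (g : G → ℝ)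
    (hg : ∀ v, ∑ k ∈ Finset.range N, g (v + k • e) = 0) :
    2 * ∑ v, g v ^ 2 ≤ (N : ℝ) ^ 2 * ∑ v, groupDiff e g v ^ 2 := by
  have hexpand : ∑ k ∈ Finset.range N, ∑ v, groupDiff (k • e) g v ^ 2
      = N * (2 * ∑ v, g v ^ 2) := by
    have hcross : ∑ k ∈ Finset.range N, ∑ v, g v * g (v + k • e) = 0 := by
      rw [Finset.sum_comm]
      simp only [← Finset.mul_sum, hg, mul_zero, Finset.sum_const_zero]
    have hk (k : ℕ) : ∑ v, groupDiff (k • e) g v ^ 2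
        = 2 * ∑ v, g v ^ 2 - 2 * ∑ v, g v * g (v + k • e) := by
      have h := sum_comp_add_right (k • e) fun v => g v ^ 2
      rw [two_mul (∑ v, g v ^ 2)]
      nth_rewrite 1 [← h]
      rw [Finset.mul_sum, ← Finset.sum_add_distrib, ← Finset.sum_sub_distrib]
      refine Finset.sum_congr rfl fun v _ => ?_
      simp only [groupDiff]
      ring
    simp only [hk, Finset.sum_sub_distrib, ← Finset.mul_sum, hcross, Finset.sum_const,
      Finset.card_range, nsmul_eq_mul]
    ring
  have hbound : ∑ k ∈ Finset.range N, ∑ v, groupDiff (k • e) g v ^ 2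
      ≤ N * ((N : ℝ) ^ 2 * ∑ v, groupDiff e g v ^ 2) := by
    rw [← nsmul_eq_mul]
    refine (Finset.sum_le_card_nsmul _ _ _ fun k hk => ?_).trans_eq
      (by rw [Finset.card_range])
    refine (sum_sq_groupDiff_nsmul_le e g k).trans ?_
    have : k ≤ N := (Finset.mem_range.mp hk).le
    gcongr
  have hN' : (0 : ℝ) < N := by exact_mod_cast hN
  exact le_of_mul_le_mul_left (hexpand.symm.trans_le hbound) hN'

theorem two_mul_sum_sq_groupDiff_le {N : ℕ} (hN : 0 < N) (e : G) (he : N • e = 0)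
    (f : G → ℝ) :
    2 * ∑ v, groupDiff e f v ^ 2 ≤ (N : ℝ) ^ 2 * ∑ v, groupDiff e (groupDiff e f) v ^ 2 := by
  refine two_mul_sum_sq_le_of_orbit_sum_eq_zero hN e _ fun v => ?_
  have h := Finset.sum_range_sub (fun j : ℕ => f (v + j • e)) N
  simpa only [groupDiff, zero_smul, add_zero, succ_nsmul, ← add_assoc, he, sub_self] using h

theorem sum_sq_groupDiff_groupDiff_le {ι : Type*} [Fintype ι] (e : ι → G) (f : G → ℝ) :
    ∑ i, ∑ v, groupDiff (e i) (groupDiff (e i) f) v ^ 2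
      ≤ ∑ v, (∑ i, groupDiff₂ (e i) f v) ^ 2 := by
  have h : ∑ v, (∑ i, groupDiff₂ (e i) f v) ^ 2
      = ∑ i, ∑ j, ∑ v, groupDiff (e i) (groupDiff (e j) f) v ^ 2 := by
    simp only [← sum_groupDiff₂_mul_groupDiff₂]
    simp only [sq, Finset.sum_mul_sum]
    rw [Finset.sum_comm]
    exact Finset.sum_congr rfl fun i _ => Finset.sum_comm
  rw [h]
  refine Finset.sum_le_sum fun i _ => ?_
  exact Finset.single_le_sum
    (f := fun j => ∑ v, groupDiff (e i) (groupDiff (e j) f) v ^ 2)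
    (fun j _ => Finset.sum_nonneg fun v _ => sq_nonneg _) (Finset.mem_univ i)

end GroupDiff

/-- Uniform discrete elliptic estimate: `‖∇_h f‖₂ ≤ C₃ ‖Δ_h f‖₂` with `C₃`
depending only on `L`. -/
theorem discrete_elliptic_estimate (L : ℝ) (hL : 0 < L) :
    ∃ C₃ : ℝ, 0 < C₃ ∧ ∀ (N : ℕ) [NeZero N] (f : (Fin 3 → ZMod N) → ℝ),
      gridGradNorm N (L / N) f ≤ C₃ * gridL2 N (L / N) (gridLap N (L / N) f) := by
  refine ⟨L, hL, fun N _ f => ?_⟩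
  have hN : 0 < N := Nat.pos_of_ne_zero (NeZero.ne N)
  have hN' : (0 : ℝ) < N := by exact_mod_cast hN
  set h : ℝ := L / N with h_def
  have hh : 0 < h := div_pos hL hN'
  let e : Fin 3 → Fin 3 → ZMod N := fun i => Pi.single i 1
  have he (i : Fin 3) : N • e i = 0 := by
    ext j
    simp
  have hgrad : ∑ v, ∑ i, gridD N h i f v ^ 2
      = (∑ i, ∑ v, groupDiff (e i) f v ^ 2) / h ^ 2 := by
    rw [Finset.sum_comm]
    simp only [gridD, div_pow, ← Finset.sum_div]
    rfl
  have hlap : ∑ v, gridLap N h f v ^ 2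
      = (∑ v, (∑ i, groupDiff₂ (e i) f v) ^ 2) / h ^ 4 := by
    simp only [gridLap, div_pow, ← Finset.sum_div, ← pow_mul]
    rfl
  have hpoincare : ∑ i, ∑ v, groupDiff (e i) f v ^ 2
      ≤ (N : ℝ) ^ 2 * ∑ v, (∑ i, groupDiff₂ (e i) f v) ^ 2 := by
    refine le_trans ?_ (mul_le_mul_of_nonneg_left (sum_sq_groupDiff_groupDiff_le e f)
      (sq_nonneg _))
    rw [Finset.mul_sum]
    refine Finset.sum_le_sum fun i _ => ?_
    have hnonneg : 0 ≤ ∑ v, groupDiff (e i) f v ^ 2 :=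
      Finset.sum_nonneg fun v _ => sq_nonneg _
    linarith [two_mul_sum_sq_groupDiff_le hN (e i) (he i) f]
  have hLN : L = N * h := by
    rw [h_def]
    field_simp
  rw [gridGradNorm, gridL2]
  refine Real.sqrt_le_iff.mpr ⟨by positivity, ?_⟩
  rw [mul_pow, Real.sq_sqrt (by positivity), hgrad, hlap, mul_left_comm]
  refine mul_le_mul_of_nonneg_left ?_ (by positivity)
  calc (∑ i, ∑ v, groupDiff (e i) f v ^ 2) / h ^ 2
      ≤ ((N : ℝ) ^ 2 * ∑ v, (∑ i, groupDiff₂ (e i) f v) ^ 2) / h ^ 2 := by gcongr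
    _ = L ^ 2 * ((∑ v, (∑ i, groupDiff₂ (e i) f v) ^ 2) / h ^ 4) := by
        rw [hLN]
        field_simp
end

section
/- Discrete Gagliardo–Nirenberg-type interpolation: for every periodic grid function f, one has ‖∇_h Δ_h f‖₂³ ≤ ‖Δ_h f‖₂² · ‖∇_h Δ_h² f‖₂, where Δ_h² denotes the discrete Laplacian applied twice. -/
/-- Summation by parts in a single direction. -/
theorem sum_mul_secondDifference {G : Type*} [AddCommGroup G] [Fintype G] (u w : G → ℝ) (e : G) :
    ∑ v, u v * (w (v + e) - 2 * w v + w (v - e))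
      = -∑ v, (u (v + e) - u v) * (w (v + e) - w v) := by
  have hshift : ∑ v, u (v + e) * (w (v + e) - w v) = ∑ v, u v * (w v - w (v - e)) := by
    rw [← Equiv.sum_comp (Equiv.addRight e) fun v => u v * (w v - w (v - e))]
    simp
  calc ∑ v, u v * (w (v + e) - 2 * w v + w (v - e))
      = ∑ v, u v * (w (v + e) - w v) - ∑ v, u v * (w v - w (v - e)) := by
        rw [← Finset.sum_sub_distrib]
        exact Finset.sum_congr rfl fun v _ => by ring
    _ = -∑ v, (u (v + e) - u v) * (w (v + e) - w v) := by
        rw [← hshift, ← Finset.sum_sub_distrib, ← Finset.sum_neg_distrib]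
        exact Finset.sum_congr rfl fun v _ => by ring

/-- Discrete Green identity `⟨u, Δ_h w⟩ = -⟨∇_h u, ∇_h w⟩`. -/
theorem sum_mul_gridLap (N : ℕ) [NeZero N] (h : ℝ) (u w : (Fin 3 → ZMod N) → ℝ) :
    ∑ v, u v * gridLap N h w v = -∑ v, ∑ i : Fin 3, gridD N h i u v * gridD N h i w v := by
  simp only [gridLap, gridD, Finset.mul_sum]
  rw [Finset.sum_comm, Finset.sum_comm (s := Finset.univ (α := Fin 3 → ZMod N)),
    ← Finset.sum_neg_distrib]
  refine Finset.sum_congr rfl fun i _ => ?_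
  simp only [div_mul_div_comm, ← pow_two]
  simp only [← mul_div_assoc, ← Finset.sum_div]
  rw [sum_mul_secondDifference, neg_div]

theorem gridL2_nonneg (N : ℕ) [NeZero N] (h : ℝ) (u : (Fin 3 → ZMod N) → ℝ) :
    0 ≤ gridL2 N h u :=
  Real.sqrt_nonneg _

theorem gridGradNorm_nonneg (N : ℕ) [NeZero N] (h : ℝ) (u : (Fin 3 → ZMod N) → ℝ) :
    0 ≤ gridGradNorm N h u :=
  Real.sqrt_nonneg _

theorem gridL2_sq (N : ℕ) [NeZero N] {h : ℝ} (hh : 0 ≤ h) (u : (Fin 3 → ZMod N) → ℝ) :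
    gridL2 N h u ^ 2 = h ^ 3 * ∑ v, u v ^ 2 :=
  Real.sq_sqrt (by positivity)

theorem gridGradNorm_sq (N : ℕ) [NeZero N] {h : ℝ} (hh : 0 ≤ h) (u : (Fin 3 → ZMod N) → ℝ) :
    gridGradNorm N h u ^ 2 = h ^ 3 * ∑ v, ∑ i : Fin 3, gridD N h i u v ^ 2 :=
  Real.sq_sqrt (by positivity)

/-- Interpolation of the gradient norm between `‖u‖₂` and `‖Δ_h u‖₂`. -/
theorem gridGradNorm_sq_le (N : ℕ) [NeZero N] {h : ℝ} (hh : 0 ≤ h) (u : (Fin 3 → ZMod N) → ℝ) :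
    gridGradNorm N h u ^ 2 ≤ gridL2 N h u * gridL2 N h (gridLap N h u) := by
  have hcs := Finset.sum_mul_sq_le_sq_mul_sq Finset.univ u (gridLap N h u)
  rw [sum_mul_gridLap, neg_sq] at hcs
  simp only [← pow_two] at hcs
  refine (pow_le_pow_iff_left₀ (sq_nonneg _)
    (mul_nonneg (gridL2_nonneg N h _) (gridL2_nonneg N h _))
    two_ne_zero).1 ?_
  rw [mul_pow, gridGradNorm_sq N hh, gridL2_sq N hh, gridL2_sq N hh, mul_pow, mul_mul_mul_comm,
    ← pow_two (h ^ 3)]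
  exact mul_le_mul_of_nonneg_left hcs (by positivity)

/-- Interpolation of `‖Δ_h u‖₂` between `‖∇_h u‖₂` and `‖∇_h Δ_h u‖₂`. -/
theorem gridL2_gridLap_sq_le (N : ℕ) [NeZero N] {h : ℝ} (hh : 0 ≤ h)
    (u : (Fin 3 → ZMod N) → ℝ) :
    gridL2 N h (gridLap N h u) ^ 2 ≤ gridGradNorm N h u * gridGradNorm N h (gridLap N h u) := by
  have hcs := Finset.sum_mul_sq_le_sq_mul_sq Finset.univ
    (fun p : (Fin 3 → ZMod N) × Fin 3 => gridD N h p.2 (gridLap N h u) p.1)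
    (fun p => gridD N h p.2 u p.1)
  simp only [Fintype.sum_prod_type] at hcs
  rw [← neg_sq, ← sum_mul_gridLap, mul_comm] at hcs
  simp only [← pow_two] at hcs
  refine (pow_le_pow_iff_left₀ (sq_nonneg _)
    (mul_nonneg (gridGradNorm_nonneg N h _) (gridGradNorm_nonneg N h _))
    two_ne_zero).1 ?_
  rw [mul_pow, gridGradNorm_sq N hh, gridGradNorm_sq N hh, gridL2_sq N hh, mul_pow,
    mul_mul_mul_comm, ← pow_two (h ^ 3)]
  exact mul_le_mul_of_nonneg_left hcs (by positivity)

/-- Interpolation of the gradient norm between `‖u‖₂` and `‖∇_h Δ_h u‖₂`. -/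
theorem gridGradNorm_pow_three_le (N : ℕ) [NeZero N] {h : ℝ} (hh : 0 ≤ h)
    (u : (Fin 3 → ZMod N) → ℝ) :
    gridGradNorm N h u ^ 3 ≤ gridL2 N h u ^ 2 * gridGradNorm N h (gridLap N h u) := by
  obtain hq | hq := (gridGradNorm_nonneg N h u).eq_or_lt
  · rw [← hq, zero_pow three_ne_zero]
    exact mul_nonneg (sq_nonneg _) (gridGradNorm_nonneg N h _)
  · refine le_of_mul_le_mul_right ?_ hq
    calc gridGradNorm N h u ^ 3 * gridGradNorm N h u = (gridGradNorm N h u ^ 2) ^ 2 := by ring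
      _ ≤ (gridL2 N h u * gridL2 N h (gridLap N h u)) ^ 2 :=
        pow_le_pow_left₀ (sq_nonneg _) (gridGradNorm_sq_le N hh u) 2
      _ = gridL2 N h u ^ 2 * gridL2 N h (gridLap N h u) ^ 2 := mul_pow _ _ _
      _ ≤ gridL2 N h u ^ 2 * (gridGradNorm N h u * gridGradNorm N h (gridLap N h u)) :=
        mul_le_mul_of_nonneg_left (gridL2_gridLap_sq_le N hh u) (sq_nonneg _)
      _ = gridL2 N h u ^ 2 * gridGradNorm N h (gridLap N h u) * gridGradNorm N h u := by ring

/-- Discrete Gagliardo–Nirenberg-type interpolation: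
`‖∇_h Δ_h f‖₂³ ≤ ‖Δ_h f‖₂² · ‖∇_h Δ_h² f‖₂`. -/
theorem discrete_GN_interpolation (L : ℝ) (hL : 0 < L) (N : ℕ) [NeZero N]
    (f : (Fin 3 → ZMod N) → ℝ) :
    gridGradNorm N (L / N) (gridLap N (L / N) f) ^ 3
      ≤ gridL2 N (L / N) (gridLap N (L / N) f) ^ 2 *
        gridGradNorm N (L / N) (gridLap N (L / N) (gridLap N (L / N) f)) :=
  gridGradNorm_pow_three_le N (by positivity) _
end

section
/- H² bound from the discrete energy: for every ε with 0 < ε < 1 and every periodic grid function f, one has ‖Δ_h f‖₂² ≤ 4 ( E_h(f) + L³ ), where E_h(f) = (1/4) h³ ∑_v f(v)⁴ + ((1−ε)/2) ‖f‖₂² − ‖∇_h f‖₂² + (1/2) ‖Δ_h f‖₂² is the discrete phase field crystal energy. -/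
/-- The discrete phase field crystal energy
`E_h(f) = (1/4) h³ ∑_v f(v)⁴ + ((1−ε)/2)‖f‖₂² − ‖∇_h f‖₂² + (1/2)‖Δ_h f‖₂²`. -/
noncomputable def gridEnergy (N : ℕ) [NeZero N] (h ε : ℝ)
    (f : (Fin 3 → ZMod N) → ℝ) : ℝ :=
  (1 / 4) * (h ^ 3 * ∑ v : Fin 3 → ZMod N, f v ^ 4) +
    ((1 - ε) / 2) * gridL2 N h f ^ 2 - gridGradNorm N h f ^ 2 +
    (1 / 2) * gridL2 N h (gridLap N h f) ^ 2

/-- Summation by parts for the second difference on a finite abelian group. -/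
theorem sum_sq_forward_diff {G : Type*} [AddCommGroup G] [Fintype G] (f : G → ℝ) (e : G) :
    ∑ v, (f (v + e) - f v) ^ 2 = -∑ v, f v * (f (v + e) - 2 * f v + f (v - e)) := by
  have h1 : ∑ v, f (v + e) ^ 2 = ∑ v, f v ^ 2 :=
    Equiv.sum_comp (Equiv.addRight e) fun v => f v ^ 2
  have h2 : ∑ v, f (v + e) * f v = ∑ v, f v * f (v - e) := by
    simpa using Equiv.sum_comp (Equiv.addRight e) fun v => f v * f (v - e)
  have h3 : ∑ v, (f (v + e) - f v) ^ 2 + ∑ v, f v * (f (v + e) - 2 * f v + f (v - e))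
      = (∑ v, f (v + e) ^ 2 - ∑ v, f v ^ 2) +
        (∑ v, f v * f (v - e) - ∑ v, f (v + e) * f v) := by
    simp only [← Finset.sum_add_distrib, ← Finset.sum_sub_distrib]
    exact Finset.sum_congr rfl fun v _ => by ring
  linarith

/-- Discrete Green identity: `∑_v |∇_h f(v)|² = -∑_v f(v) (Δ_h f)(v)`. -/
theorem sum_gridD_sq (N : ℕ) [NeZero N] (h : ℝ) (f : (Fin 3 → ZMod N) → ℝ) :
    ∑ v, ∑ i, gridD N h i f v ^ 2 = -∑ v, f v * gridLap N h f v := by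
  simp only [gridD, gridLap, Finset.mul_sum, div_pow]
  rw [Finset.sum_comm, Finset.sum_comm (s := Finset.univ (α := Fin 3 → ZMod N)),
    ← Finset.sum_neg_distrib]
  refine Finset.sum_congr rfl fun i _ => ?_
  simp only [← mul_div_assoc]
  rw [← Finset.sum_div, ← Finset.sum_div, sum_sq_forward_diff, neg_div]

/-- `H²` bound from the discrete energy: `‖Δ_h f‖₂² ≤ 4 (E_h(f) + L³)`. -/
theorem H2_bound_from_energy (L : ℝ) (hL : 0 < L) (N : ℕ) [NeZero N]
    (ε : ℝ) (hε0 : 0 < ε) (hε1 : ε < 1) (f : (Fin 3 → ZMod N) → ℝ) :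
    gridL2 N (L / N) (gridLap N (L / N) f) ^ 2
      ≤ 4 * (gridEnergy N (L / N) ε f + L ^ 3) := by
  have hN : (N : ℝ) ≠ 0 := Nat.cast_ne_zero.mpr (NeZero.ne N)
  set h : ℝ := L / N with hh
  have hh3 : 0 ≤ h ^ 3 := by positivity
  have hvol : L ^ 3 = h ^ 3 * ∑ _v : Fin 3 → ZMod N, (1 : ℝ) := by
    simp [hh, ZMod.card]
    field_simp
  have hf : 0 ≤ (1 - ε) * gridL2 N h f ^ 2 := mul_nonneg (by linarith) (sq_nonneg _)
  have hgrad : gridGradNorm N h f ^ 2 = -(h ^ 3 * ∑ v, f v * gridLap N h f v) := by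
    rw [gridGradNorm, Real.sq_sqrt (by positivity), sum_gridD_sq, mul_neg]
  have hlap : gridL2 N h (gridLap N h f) ^ 2 = h ^ 3 * ∑ v, gridLap N h f v ^ 2 := by
    rw [gridL2, Real.sq_sqrt (by positivity)]
  have key : 0 ≤ h ^ 3 * ∑ v, ((f v ^ 2 - 2) ^ 2 + (2 * f v + gridLap N h f v) ^ 2) := by
    positivity
  have expand : ∑ v, ((f v ^ 2 - 2) ^ 2 + (2 * f v + gridLap N h f v) ^ 2)
      = ∑ v, f v ^ 4 + 4 * ∑ _v : Fin 3 → ZMod N, (1 : ℝ) +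
        4 * ∑ v, f v * gridLap N h f v + ∑ v, gridLap N h f v ^ 2 := by
    simp only [Finset.mul_sum, ← Finset.sum_add_distrib]
    exact Finset.sum_congr rfl fun v _ => by ring
  rw [expand] at key
  rw [gridEnergy, hgrad, hlap, hvol]
  linarith
end
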